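/- Let G be a finite simple well-covered graph with independence number α(G) = r and let H be the complement of G. Then the W-index of G equals the minimum (r−1)-clique-codegree of H, that is, w(G) = δ^cl_{r−1}(H). -/

import Mathlib

open Finset
open scoped Classical

/-- `S` is an independent set of the graph `G`. -/
def IsIndep {V : Type*} (G : SimpleGraph V) (S : Finset V) : Prop :=
  ∀ ⦃x⦄, x ∈ S → ∀ ⦃y⦄, y ∈ S → x ≠ y → ¬ G.Adj x y

/-- The independence number `α(G)` of a finite graph `G`. -/
noncomputable def alpha {V : Type*} [Fintype V] (G : SimpleGraph V) : ℕ :=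
  Finset.univ.sup fun S : Finset V => if IsIndep G S then S.card else 0

/-- `S` is a maximum independent set of `G`. -/
def IsMaxIndep {V : Type*} [Fintype V] (G : SimpleGraph V) (S : Finset V) : Prop :=
  IsIndep G S ∧ S.card = alpha G

/-- `S` is a maximal (inclusion-wise) independent set of `G`. -/
def IsMaximalIndep {V : Type*} [DecidableEq V] (G : SimpleGraph V) (S : Finset V) : Prop :=
  IsIndep G S ∧ ∀ x, x ∉ S → ¬ IsIndep G (insert x S)

/-- `G` is well-covered: every maximal independent set has cardinality `α(G)`. -/
def WellCovered {V : Type*} [Fintype V] [DecidableEq V] (G : SimpleGraph V) : Prop :=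
  ∀ S : Finset V, IsMaximalIndep G S → S.card = alpha G

/-- `G ∈ W_p`: `|V(G)| ≥ p` and every `p` pairwise disjoint independent sets extend to
`p` pairwise disjoint maximum independent sets. -/
def MemW {V : Type*} [Fintype V] (G : SimpleGraph V) (p : ℕ) : Prop :=
  p ≤ Fintype.card V ∧
    ∀ A : Fin p → Finset V, (∀ i, IsIndep G (A i)) →
      (∀ i j, i ≠ j → Disjoint (A i) (A j)) →
      ∃ M : Fin p → Finset V, (∀ i, IsMaxIndep G (M i)) ∧
        (∀ i j, i ≠ j → Disjoint (M i) (M j)) ∧ ∀ i, A i ⊆ M i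

/-- The `W`-index of `G`: the largest `p` with `G ∈ W_p`. -/
noncomputable def wIndex {V : Type*} [Fintype V] (G : SimpleGraph V) : ℕ :=
  sSup {p : ℕ | MemW G p}

/-- The fiber `F_G(S)`: the vertices `x ∉ S` with `S ∪ {x}` a maximum independent set. -/
noncomputable def fiber {V : Type*} [Fintype V] [DecidableEq V]
    (G : SimpleGraph V) (S : Finset V) : Finset V :=
  Finset.univ.filter fun x => x ∉ S ∧ IsMaxIndep G (insert x S)

/-- `G` is `α`-critical: deleting any edge increases the independence number. -/
def AlphaCritical {V : Type*} [Fintype V] (G : SimpleGraph V) : Prop :=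
  ∀ x y, G.Adj x y → alpha G < alpha (G.deleteEdges {s(x, y)})

/-- `H` is `K_t`-saturated: `H` is `K_t`-free but adding any missing edge creates a `K_t`. -/
def KSaturated {V : Type*} [Fintype V] (H : SimpleGraph V) (t : ℕ) : Prop :=
  (∀ Q : Finset V, ¬ H.IsNClique t Q) ∧
    ∀ x y : V, x ≠ y → ¬ H.Adj x y →
      ∃ Q : Finset V, (H ⊔ SimpleGraph.fromEdgeSet {s(x, y)}).IsNClique t Q

/-- `Q` is an inclusion-maximal clique of `H`. -/
def IsMaximalClique {V : Type*} [DecidableEq V] (H : SimpleGraph V) (Q : Finset V) : Prop :=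
  H.IsClique (Q : Set V) ∧ ∀ x, x ∉ Q → ¬ H.IsClique ((insert x Q : Finset V) : Set V)

/-- The `(r-1)`-clique-codegree of `Q` in `H`: the number of vertices extending `Q`
to an `r`-clique of `H`. -/
noncomputable def codeg {V : Type*} [Fintype V] [DecidableEq V]
    (H : SimpleGraph V) (r : ℕ) (Q : Finset V) : ℕ :=
  (Finset.univ.filter fun x => x ∉ Q ∧ H.IsNClique r (insert x Q)).card

/-- The minimum `(r-1)`-clique-codegree `δ^cl_{r-1}(H)`. -/
noncomputable def minCliqueCodeg {V : Type*} [Fintype V] [DecidableEq V]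
    (H : SimpleGraph V) (r : ℕ) : ℕ :=
  sInf {m : ℕ | ∃ Q : Finset V, H.IsNClique (r - 1) Q ∧ codeg H r Q = m}

/-- The vertex set of the localization `G_S = G - N_G[S]`. -/
noncomputable def localVerts {V : Type*} [Fintype V] (G : SimpleGraph V) (S : Finset V) :
    Finset V :=
  Finset.univ.filter fun v => v ∉ S ∧ ∀ s ∈ S, ¬ G.Adj s v

/-- The localization `G_S = G - N_G[S]`, as an induced subgraph. -/
noncomputable def localize {V : Type*} [Fintype V] (G : SimpleGraph V) (S : Finset V) :
    SimpleGraph {v : V // v ∈ localVerts G S} :=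
  SimpleGraph.comap (fun v => (v : V)) G

/-- The vertex set of the edge-localization `G_{ab} = G - (N_G(a) ∪ N_G(b))`. -/
noncomputable def edgeVerts {V : Type*} [Fintype V] (G : SimpleGraph V) (a b : V) : Finset V :=
  Finset.univ.filter fun v => ¬ G.Adj a v ∧ ¬ G.Adj b v

/-- The edge-localization `G_{ab} = G - (N_G(a) ∪ N_G(b))`, as an induced subgraph. -/
noncomputable def edgeLocalize {V : Type*} [Fintype V] (G : SimpleGraph V) (a b : V) :
    SimpleGraph {v : V // v ∈ edgeVerts G a b} :=
  SimpleGraph.comap (fun v => (v : V)) G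

theorem isIndep_subset {V : Type*} {G : SimpleGraph V} {S T : Finset V}
    (hT : IsIndep G T) (h : S ⊆ T) : IsIndep G S :=
  fun _ hx _ hy hxy => hT (h hx) (h hy) hxy

theorem isIndep_empty {V : Type*} (G : SimpleGraph V) : IsIndep G (∅ : Finset V) :=
  fun _ hx => absurd hx (Finset.notMem_empty _)

theorem isIndep_singleton {V : Type*} (G : SimpleGraph V) (v : V) :
    IsIndep G ({v} : Finset V) := by
  intro x hx y hy hxy
  simp_all

theorem isNClique_compl_iff_isIndep {V : Type*} {G : SimpleGraph V} {n : ℕ} {Q : Finset V} :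
    Gᶜ.IsNClique n Q ↔ IsIndep G Q ∧ Q.card = n := by
  rw [SimpleGraph.isNClique_iff]
  refine and_congr_left fun _ => ⟨fun h x hx y hy hxy => ?_, fun h x hx y hy hxy => ?_⟩
  · exact ((SimpleGraph.compl_adj _ _ _).1 (h hx hy hxy)).2
  · exact (SimpleGraph.compl_adj _ _ _).2 ⟨hxy, h hx hy hxy⟩

theorem card_le_alpha {V : Type*} [Fintype V] {G : SimpleGraph V} {S : Finset V}
    (hS : IsIndep G S) : S.card ≤ alpha G := by
  have h := Finset.le_sup (f := fun S : Finset V => if IsIndep G S then S.card else 0)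
    (Finset.mem_univ S)
  simp only [hS, if_true] at h
  exact h

/-- In a well-covered graph every independent set extends to a maximum one. -/
theorem WellCovered.exists_isMaxIndep {V : Type*} [Fintype V] [DecidableEq V]
    {G : SimpleGraph V} (hwc : WellCovered G) {S : Finset V} (hS : IsIndep G S) :
    ∃ M, S ⊆ M ∧ IsMaxIndep G M := by
  obtain ⟨M, hSM, hM⟩ := (Set.toFinite {T : Finset V | IsIndep G T}).exists_le_maximal hS
  refine ⟨M, hSM, hM.1, hwc M ⟨hM.1, fun x hx hxM => ?_⟩⟩
  exact hx (hM.2 hxM (Finset.subset_insert x M) (Finset.mem_insert_self x M))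

/-- In a well-covered graph every independent set of size at most `α(G) - 1` lies in an
independent set of size exactly `α(G) - 1`. -/
theorem WellCovered.exists_isNClique_compl {V : Type*} [Fintype V] [DecidableEq V]
    {G : SimpleGraph V} (hwc : WellCovered G) {S : Finset V} (hS : IsIndep G S)
    (hlt : S.card ≤ alpha G - 1) :
    ∃ Q, S ⊆ Q ∧ Gᶜ.IsNClique (alpha G - 1) Q := by
  obtain ⟨M, hSM, hM⟩ := hwc.exists_isMaxIndep hS
  obtain ⟨Q, hSQ, hQM, hQ⟩ := Finset.exists_subsuperset_card_eq hSM hlt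
    (hM.2 ▸ Nat.sub_le _ _)
  exact ⟨Q, hSQ, isNClique_compl_iff_isIndep.2 ⟨isIndep_subset hM.1 hQM, hQ⟩⟩

/-- Two vertices extending an independent set of size `α(G) - 1` to maximum independent sets
are adjacent. -/
theorem adj_of_isIndep_insert {V : Type*} [Fintype V] [DecidableEq V] {G : SimpleGraph V}
    {Q : Finset V} {x y : V} (hQ : Q.card + 1 = alpha G) (hx : x ∉ Q) (hy : y ∉ Q)
    (hxQ : IsIndep G (insert x Q)) (hyQ : IsIndep G (insert y Q)) (hxy : x ≠ y) :
    G.Adj x y := by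
  by_contra hadj
  have hind : IsIndep G (insert x (insert y Q)) := by
    intro a ha b hb hab
    simp only [Finset.mem_insert] at ha hb
    rcases ha with rfl | rfl | ha <;> rcases hb with rfl | rfl | hb
    · exact absurd rfl hab
    · exact hadj
    · exact hxQ (by simp) (by simp [hb]) hab
    · exact fun h => hadj h.symm
    · exact absurd rfl hab
    · exact hyQ (by simp) (by simp [hb]) hab
    · exact hxQ (by simp [ha]) (by simp) hab
    · exact hyQ (by simp [ha]) (by simp) hab
    · exact hxQ (by simp [ha]) (by simp [hb]) hab
  have h := card_le_alpha hind
  rw [Finset.card_insert_of_notMem (by simp [hxy, hx]), Finset.card_insert_of_notMem hy] at h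
  omega

/-- The clique-codegree in the complement counts the vertices extending an independent set. -/
theorem exists_card_eq_codeg_compl {V : Type*} [Fintype V] [DecidableEq V] {G : SimpleGraph V}
    {Q : Finset V} {r : ℕ} (hQ : Q.card + 1 = r) :
    ∃ F : Finset V, F.card = codeg Gᶜ r Q ∧ ∀ x, x ∈ F ↔ x ∉ Q ∧ IsIndep G (insert x Q) := by
  refine ⟨Finset.univ.filter fun x => x ∉ Q ∧ Gᶜ.IsNClique r (insert x Q), ?_, fun x => ?_⟩
  · unfold codeg
    congr
  rw [Finset.mem_filter, isNClique_compl_iff_isIndep]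
  refine ⟨fun h => ⟨h.2.1, h.2.2.1⟩, fun h => ⟨Finset.mem_univ x, h.1, h.2, ?_⟩⟩
  rw [Finset.card_insert_of_notMem h.1, hQ]

/-- A set with fewer than `p` elements injects into `Fin p` with some value omitted. -/
theorem exists_injOn_ne {V : Type*} {F : Finset V} {p : ℕ} (hF : F.card < p) :
    ∃ (z : Fin p) (g : V → Fin p), (∀ x ∈ F, g x ≠ z) ∧ Set.InjOn g F := by
  obtain ⟨n, rfl⟩ : ∃ n, p = n + 1 := ⟨p - 1, by omega⟩
  have hc : F.card ≤ (Finset.univ.erase (0 : Fin (n + 1))).card := by simp; omega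
  obtain ⟨g, hg, hinj⟩ := F.finite_toSet.exists_injOn_of_encard_le
    (t := ((Finset.univ.erase (0 : Fin (n + 1)) : Finset (Fin (n + 1))) : Set (Fin (n + 1))))
    (by rw [Set.encard_coe_eq_coe_finsetCard, Set.encard_coe_eq_coe_finsetCard]
        exact Nat.cast_le.2 hc)
  exact ⟨0, g, fun x hx => by simpa using hg hx, hinj⟩

theorem MemW.le_codeg {V : Type*} [Fintype V] [DecidableEq V] {G : SimpleGraph V} {p : ℕ}
    (hp : MemW G p) {Q : Finset V} (hQ : Gᶜ.IsNClique (alpha G - 1) Q) :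
    p ≤ codeg Gᶜ (alpha G) Q := by
  by_contra! hlt
  obtain ⟨hQi, hQc⟩ := isNClique_compl_iff_isIndep.1 hQ
  have hV : 0 < Fintype.card V := by have := hp.1; omega
  obtain ⟨v⟩ := Fintype.card_pos_iff.1 hV
  have halpha : 1 ≤ alpha G := by simpa using card_le_alpha (isIndep_singleton G v)
  obtain ⟨F, hF, hFmem⟩ := exists_card_eq_codeg_compl (G := G) (Q := Q) (r := alpha G) (by omega)
  have hFp : F.card < p := hF ▸ hlt
  obtain ⟨z, g, hgz, hg⟩ := exists_injOn_ne hFp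
  have hFQ : ∀ x ∈ F, x ∉ Q := fun x hx => ((hFmem x).1 hx).1
  obtain ⟨M, hM, hMd, hAM⟩ := hp.2
    (fun i => if i = z then Q else F.filter fun x => g x = i) (by
      intro i
      split_ifs
      · exact hQi
      · intro x hx y hy hxy
        rw [Finset.mem_filter] at hx hy
        exact absurd (hg hx.1 hy.1 (hx.2.trans hy.2.symm)) hxy) (by
      intro i j hij
      rw [Finset.disjoint_left]
      intro x hxi hxj
      split_ifs at hxi hxj with hi hj hj
      · exact hij (hi.trans hj.symm)
      · exact hFQ x (Finset.mem_filter.1 hxj).1 hxi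
      · exact hFQ x (Finset.mem_filter.1 hxi).1 hxj
      · exact hij ((Finset.mem_filter.1 hxi).2.symm.trans (Finset.mem_filter.1 hxj).2))
  have hQM : Q ⊆ M z := by simpa using hAM z
  have hMz := hM z
  obtain ⟨x, hxM, hxQ⟩ : ∃ x ∈ M z, x ∉ Q :=
    Finset.exists_mem_notMem_of_card_lt_card (by rw [hMz.2]; omega)
  have hxF : x ∈ F :=
    (hFmem x).2 ⟨hxQ, isIndep_subset hMz.1 (Finset.insert_subset hxM hQM)⟩
  refine Finset.disjoint_left.1 (hMd _ z (hgz x hxF)) (hAM (g x) ?_) hxM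
  simp [hgz x hxF, hxF]

theorem WellCovered.memW_of_le_codeg {V : Type*} [Fintype V] [DecidableEq V]
    {G : SimpleGraph V} (hwc : WellCovered G) {p : ℕ}
    (hp : ∀ Q, Gᶜ.IsNClique (alpha G - 1) Q → p ≤ codeg Gᶜ (alpha G) Q) : MemW G p := by
  refine ⟨?_, fun A hA hAd => ?_⟩
  · obtain ⟨Q, -, hQ⟩ := hwc.exists_isNClique_compl (isIndep_empty G) (by simp)
    exact (hp Q hQ).trans (Finset.card_le_univ _)
  obtain ⟨M, hAM, ⟨hMi, hMd⟩, hM⟩ := (Set.toFinite {B : Fin p → Finset V |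
    (∀ i, IsIndep G (B i)) ∧ ∀ i j, i ≠ j → Disjoint (B i) (B j)}).exists_le_maximal ⟨hA, hAd⟩
  refine ⟨M, fun i => ⟨hMi i, ?_⟩, hMd, hAM⟩
  by_contra hne
  have hlt := lt_of_le_of_ne (card_le_alpha (hMi i)) hne
  obtain ⟨Q, hMQ, hQ⟩ := hwc.exists_isNClique_compl (hMi i) (by omega)
  have hQc := (isNClique_compl_iff_isIndep.1 hQ).2
  have hFp := hp Q hQ
  obtain ⟨F, hF, hFmem⟩ := exists_card_eq_codeg_compl (G := G) (Q := Q) (r := alpha G) (by omega)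
  obtain ⟨x, hxF, hx⟩ : ∃ x ∈ F, ∀ j, j ≠ i → x ∉ M j := by
    by_contra! h
    have : Nonempty (Fin p) := ⟨i⟩
    choose! g hgi hg using h
    have hcard : F.card ≤ (Finset.univ.erase i).card := by
      refine Finset.card_le_card_of_injOn g (fun x hx => by simpa using hgi x hx) ?_
      intro x hx y hy hxy
      by_contra hne
      obtain ⟨hxQ, hxi⟩ := (hFmem x).1 hx
      obtain ⟨hyQ, hyi⟩ := (hFmem y).1 hy
      exact hMi (g x) (hg x hx) (hxy ▸ hg y hy) hne
        (adj_of_isIndep_insert (by omega) hxQ hyQ hxi hyi hne)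
    rw [Finset.card_erase_of_mem (Finset.mem_univ i), Finset.card_univ, Fintype.card_fin] at hcard
    have := i.pos
    omega
  obtain ⟨hxQ, hxi⟩ := (hFmem x).1 hxF
  have hle : M ≤ Function.update M i (insert x (M i)) := by
    intro j
    by_cases hj : j = i
    · subst hj; simp
    · simp [hj]
  have hmem := hM (y := Function.update M i (insert x (M i))) ⟨fun j => ?_, fun j k hjk => ?_⟩ hle i
  · rw [Function.update_self] at hmem
    exact hxQ (hMQ (hmem (Finset.mem_insert_self x _)))
  · by_cases hj : j = i
    · subst hj
      rw [Function.update_self]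
      exact isIndep_subset hxi (Finset.insert_subset_insert x hMQ)
    · rw [Function.update_of_ne hj]
      exact hMi j
  · by_cases hj : j = i
    · subst hj
      rw [Function.update_self, Function.update_of_ne hjk.symm, Finset.disjoint_insert_left]
      exact ⟨hx k hjk.symm, hMd j k hjk⟩
    · rw [Function.update_of_ne hj]
      by_cases hk : k = i
      · subst hk
        rw [Function.update_self, Finset.disjoint_insert_right]
        exact ⟨hx j hj, hMd j k hjk⟩
      · rw [Function.update_of_ne hk]
        exact hMd j k hjk

/-- Exact `W`-index via the complement's minimum clique-codegree. -/
theorem wIndex_eq_minCliqueCodeg {V : Type*} [Fintype V] [DecidableEq V]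
    (G : SimpleGraph V) (r : ℕ) (hwc : WellCovered G) (halpha : alpha G = r) :
    wIndex G = minCliqueCodeg Gᶜ r := by
  subst halpha
  have hset : {p : ℕ | MemW G p} = Set.Iic (minCliqueCodeg Gᶜ (alpha G)) := by
    ext p
    refine ⟨fun hp => ?_, fun hp => hwc.memW_of_le_codeg fun Q hQ => ?_⟩
    · obtain ⟨Q, -, hQ⟩ := hwc.exists_isNClique_compl (isIndep_empty G) (by simp)
      rw [Set.mem_Iic, minCliqueCodeg]
      refine le_csInf ⟨_, Q, hQ, rfl⟩ ?_
      rintro _ ⟨Q', hQ', rfl⟩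
      exact MemW.le_codeg hp hQ'
    · exact le_trans hp (Nat.sInf_le ⟨Q, hQ, rfl⟩)
  rw [wIndex, hset, csSup_Iic]
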